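/- Let (p_i)_{i≥0} be nonnegative reals with ∑_{i≥0} p_i = 1, p_0 ∈ (0,1), p_1 < 1, and mean ∑_{i≥0} i·p_i = 1, and let f(s) = ∑_{i≥0} p_i s^i. Let κ be the least integer i ≥ 2 with p_i > 0, and set α = p_1 + (1−p_1)(1−p_0)^{κ−1}. Define the sequence (ℓ_i)_{i≥0} by ℓ_0 = p_0, ℓ_1 = 1 − f(1−p_0), and ℓ_{i+1} = f(1 − ∑_{j=0}^{i−1} ℓ_j) − f(1 − ∑_{j=0}^{i} ℓ_j) for i ≥ 1. Then α < 1 and ℓ_{i+1} ≤ α·ℓ_i for all i ≥ 1; in particular ℓ_i → 0 as i → ∞. -/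

import Mathlib

open Filter

/-- The power series of a nonnegative summable sequence is summable on `[0, 1]`. -/
theorem summable_mul_pow_of_mem_Icc {p : ℕ → ℝ} (hp : ∀ i, 0 ≤ p i) (hs : Summable p)
    {s : ℝ} (h : s ∈ Set.Icc (0 : ℝ) 1) : Summable fun i => p i * s ^ i :=
  hs.of_nonneg_of_le (fun i => mul_nonneg (hp i) (pow_nonneg h.1 i))
    fun i => mul_le_of_le_one_right (hp i) (pow_le_one₀ h.1 h.2)

theorem tsum_mul_pow_le_tsum_mul_pow {p : ℕ → ℝ} (hp : ∀ i, 0 ≤ p i) (hs : Summable p)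
    {a b : ℝ} (hb : 0 ≤ b) (hba : b ≤ a) (ha : a ≤ 1) :
    ∑' i, p i * b ^ i ≤ ∑' i, p i * a ^ i :=
  (summable_mul_pow_of_mem_Icc hp hs ⟨hb, hba.trans ha⟩).tsum_le_tsum
    (fun i => mul_le_mul_of_nonneg_left (pow_le_pow_left₀ hb hba i) (hp i))
    (summable_mul_pow_of_mem_Icc hp hs ⟨hb.trans hba, ha⟩)

/-- Let `p` have mean `1` and vanish at all indices strictly between `1` and `κ`.  Then its
generating function is Lipschitz on `[0, c]` with constant
`p 1 + (1 - p 1) * c ^ (κ - 1)`. -/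
theorem tsum_mul_pow_sub_le {p : ℕ → ℝ} (hp : ∀ i, 0 ≤ p i) (hs : Summable p)
    (hm : HasSum (fun i : ℕ => (i : ℝ) * p i) 1) {κ : ℕ}
    (hκ : ∀ i, 2 ≤ i → 0 < p i → κ ≤ i)
    {a b c : ℝ} (hb : 0 ≤ b) (hba : b ≤ a) (hac : a ≤ c) (hc : c ≤ 1) :
    ∑' i, p i * a ^ i - ∑' i, p i * b ^ i ≤
      (p 1 + (1 - p 1) * c ^ (κ - 1)) * (a - b) := by
  have ha : 0 ≤ a := hb.trans hba
  have hc0 : 0 ≤ c := ha.trans hac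
  have hsa := summable_mul_pow_of_mem_Icc hp hs ⟨ha, hac.trans hc⟩
  have hsb := summable_mul_pow_of_mem_Icc hp hs ⟨hb, hba.trans (hac.trans hc)⟩
  have hbound : HasSum (fun i : ℕ => (c ^ (κ - 1) * ((i : ℝ) * p i) +
      if i = 1 then p 1 * (1 - c ^ (κ - 1)) else 0) * (a - b))
      ((c ^ (κ - 1) * 1 + p 1 * (1 - c ^ (κ - 1))) * (a - b)) :=
    ((hm.mul_left _).add (hasSum_ite_eq 1 _)).mul_right _
  have hterm (i : ℕ) : p i * a ^ i - p i * b ^ i ≤ (c ^ (κ - 1) * ((i : ℝ) * p i) +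
      if i = 1 then p 1 * (1 - c ^ (κ - 1)) else 0) * (a - b) := by
    have hab : 0 ≤ a - b := sub_nonneg.2 hba
    rcases (hp i).eq_or_lt with h0 | hpos
    · by_cases hi : i = 1
      · subst hi; simp [← h0]
      · simp [← h0, hi]
    rcases Nat.lt_or_ge i 2 with hi | hi
    · interval_cases i
      · simp
      · simp only [pow_one, Nat.cast_one, if_true]
        linarith
    · have hdiff : a ^ i - b ^ i ≤ (a - b) * i * a ^ (i - 1) := by
        simpa [abs_of_nonneg, hab, ha, hb, hba] using
          (le_abs_self _).trans (abs_pow_sub_pow_le a b i)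
      have hpow : a ^ (i - 1) ≤ c ^ (κ - 1) :=
        (pow_le_pow_left₀ ha hac _).trans
          (pow_le_pow_of_le_one hc0 hc (Nat.sub_le_sub_right (hκ i hi hpos) 1))
      rw [if_neg (by lia), add_zero]
      calc p i * a ^ i - p i * b ^ i = p i * (a ^ i - b ^ i) := by ring
        _ ≤ p i * ((a - b) * i * c ^ (κ - 1)) := by
          refine mul_le_mul_of_nonneg_left (hdiff.trans ?_) (hp i)
          gcongr
        _ = _ := by ring
  rw [← hsa.tsum_sub hsb]
  refine ((hsa.sub hsb).tsum_le_tsum hterm hbound.summable).trans_eq ?_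
  rw [hbound.tsum_eq]
  ring

/-- For a critical offspring distribution with `p 0 ∈ (0,1)`, `p 1 < 1`,
and `κ` the least index `≥ 2` with `p κ > 0`, the leaf-height distribution `(ℓ i)`
satisfies `ℓ (i+1) ≤ α ℓ i` for `i ≥ 1` where `α = p 1 + (1 - p 1)(1 - p 0)^(κ-1) < 1`;
in particular `ℓ i → 0`. -/
theorem leaf_height_distribution_geometric_bound
    (p : ℕ → ℝ) (hp : ∀ i, 0 ≤ p i) (hsum : ∑' i, p i = 1)
    (hp0 : p 0 ∈ Set.Ioo (0 : ℝ) 1) (hp1 : p 1 < 1)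
    (hmean_summable : Summable (fun i : ℕ => (i : ℝ) * p i))
    (hmean : ∑' i : ℕ, (i : ℝ) * p i = 1)
    (κ : ℕ) (hκ : IsLeast {i : ℕ | 2 ≤ i ∧ 0 < p i} κ)
    (α : ℝ) (hα : α = p 1 + (1 - p 1) * (1 - p 0) ^ (κ - 1))
    (f : ℝ → ℝ) (hf : ∀ s ∈ Set.Icc (0 : ℝ) 1, f s = ∑' i, p i * s ^ i)
    (ℓ : ℕ → ℝ)
    (hl0 : ℓ 0 = p 0)
    (hl1 : ℓ 1 = 1 - f (1 - p 0))
    (hlrec : ∀ i : ℕ, 1 ≤ i →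
      ℓ (i + 1) = f (1 - ∑ j ∈ Finset.range i, ℓ j) -
        f (1 - ∑ j ∈ Finset.range (i + 1), ℓ j)) :
    α < 1 ∧ (∀ i : ℕ, 1 ≤ i → ℓ (i + 1) ≤ α * ℓ i) ∧
      Tendsto ℓ atTop (nhds 0) := by
  have hs : Summable p := by
    by_contra h
    simp [tsum_eq_zero_of_not_summable h] at hsum
  have hm : HasSum (fun i : ℕ => (i : ℝ) * p i) 1 := hmean ▸ hmean_summable.hasSum
  have hc0 : 0 < 1 - p 0 := sub_pos.2 hp0.2
  have hc1 : 1 - p 0 < 1 := sub_lt_self 1 hp0.1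
  have hκ2 : 2 ≤ κ := hκ.1.1
  have hα1 : α < 1 := by
    have := pow_lt_one₀ hc0.le hc1 (show κ - 1 ≠ 0 by lia)
    nlinarith
  have hα0 : 0 ≤ α := by
    have := mul_nonneg (sub_nonneg.2 hp1.le) (pow_nonneg hc0.le (κ - 1))
    linarith [hp 1]
  have hf0 : f 0 = p 0 := by
    rw [hf 0 (by simp), tsum_eq_single 0 (fun i hi => by simp [hi])]
    simp
  have hf1 : f 1 = 1 := by
    rw [hf 1 (by simp)]
    simpa using hsum
  have hmono {a b : ℝ} (hb : 0 ≤ b) (hba : b ≤ a) (ha : a ≤ 1) : f b ≤ f a := by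
    rw [hf b ⟨hb, hba.trans ha⟩, hf a ⟨hb.trans hba, ha⟩]
    exact tsum_mul_pow_le_tsum_mul_pow hp hs hb hba ha
  set q : ℕ → ℝ := fun i => 1 - ∑ j ∈ Finset.range i, ℓ j with hq
  have hℓ (i : ℕ) : ℓ i = q i - q (i + 1) := by
    simp only [hq, Finset.sum_range_succ]
    ring
  have hq0 : q 0 = 1 := by simp [hq]
  have hq1 : q 1 = 1 - p 0 := by simp [hq, hl0]
  have hqrec (i : ℕ) : q (i + 1) = f (q i) - p 0 := by
    induction i with
    | zero => rw [zero_add, hq0, hq1, hf1]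
    | succ i ih =>
      rcases i.eq_zero_or_pos with rfl | hi
      · rw [zero_add, hq1]
        linarith [hℓ 1]
      · have : ℓ (i + 1) = f (q i) - f (q (i + 1)) := hlrec i hi
        linarith [hℓ (i + 1)]
  have hq01 (i : ℕ) : q i ∈ Set.Icc (0 : ℝ) 1 := by
    induction i with
    | zero => simp [hq0]
    | succ i ih =>
      rw [hqrec]
      constructor
      · linarith [hmono le_rfl ih.1 ih.2]
      · linarith [hmono ih.1 ih.2 le_rfl, hp 0]
  have hanti : Antitone q := antitone_nat_of_succ_le fun i => by
    induction i with
    | zero => exact hq0 ▸ (hq01 1).2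
    | succ i ih =>
      linarith [hqrec (i + 1), hqrec i, hmono (hq01 _).1 ih (hq01 _).2]
  have hstep (i : ℕ) (hi : 1 ≤ i) : ℓ (i + 1) ≤ α * ℓ i := by
    rw [hlrec i hi, hα, hℓ i]
    change f (q i) - f (q (i + 1)) ≤ _
    rw [hf _ (hq01 _), hf _ (hq01 _)]
    exact tsum_mul_pow_sub_le hp hs hm (fun j hj hpj => hκ.2 ⟨hj, hpj⟩) (hq01 _).1
      (hanti i.le_succ) (hq1 ▸ hanti hi) hc1.le
  have hgeom (i : ℕ) : ℓ (i + 1) ≤ α ^ i * ℓ 1 := by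
    induction i with
    | zero => simp
    | succ i ih =>
      calc ℓ (i + 1 + 1) ≤ α * ℓ (i + 1) := hstep _ i.succ_pos
        _ ≤ α * (α ^ i * ℓ 1) := mul_le_mul_of_nonneg_left ih hα0
        _ = α ^ (i + 1) * ℓ 1 := by ring
  refine ⟨hα1, hstep, (tendsto_add_atTop_iff_nat 1).1 (squeeze_zero (fun i => ?_) hgeom ?_)⟩
  · rw [hℓ]
    exact sub_nonneg.2 (hanti (Nat.le_succ _))
  · simpa using (tendsto_pow_atTop_nhds_zero_of_lt_one hα0 hα1).mul_const (ℓ 1)
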